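/- arXiv:1409.0711 — 3 statements merged into one kernel-verified Lean document; each statement's English description precedes it below -/
import Mathlib

section
/- Let G = (V,E) be a connected simple graph on N ≥ 2 vertices, Ψ a potential on V, β > 0, and ρ* the Gibbs distribution. Let ρ(t) : [0,∞) → M be a solution of Fokker–Planck equation II, and set L(t) = Σ_{i=1}^N (ρ_i(t) − ρ*_i)²/ρ*_i, η_i(t) = (ρ_i(t) − ρ*_i)/ρ*_i and Ψ̄_i(t) = Ψ_i + β log ρ_i(t). Then for every t > 0: dL/dt = −Σ_{{a_i,a_j}∈E, Ψ̄_j(t)>Ψ̄_i(t)} 2β (log(1+η_j(t)) − log(1+η_i(t)))(η_j(t) − η_i(t)) ρ_j(t) − Σ_{{a_i,a_j}∈E, Ψ̄_j(t)=Ψ̄_i(t)} 2β (η_j(t) − η_i(t))² · (ρ*_i + ρ*_j)/2. -/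
/-!
STATEMENT 11: Dissipation identity for the weighted L² norm along solutions of
Fokker–Planck equation II.  Edge sums over unordered edges with Ψ̄_j(t) > Ψ̄_i(t)
are written as double sums filtered by Ψ̄_i(t) < Ψ̄_j(t) (each such edge appears
exactly once); the edge sum over edges with Ψ̄_i(t) = Ψ̄_j(t) has a symmetric
summand and is written as half of the corresponding double sum.
-/

open Finset Real

/-- `ρ` is a positive probability distribution on the `N` vertices. -/
def IsProbDist {N : ℕ} (ρ : Fin N → ℝ) : Prop :=
  (∀ i, 0 < ρ i) ∧ ∑ i, ρ i = 1

/-- The Gibbs distribution `ρ*_i = e^{-Ψ_i/β} / Σ_j e^{-Ψ_j/β}`. -/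
noncomputable def gibbs {N : ℕ} (Ψ : Fin N → ℝ) (β : ℝ) (i : Fin N) : ℝ :=
  Real.exp (-Ψ i / β) / ∑ j, Real.exp (-Ψ j / β)

/-- Right hand side of Fokker–Planck equation II (`Ψ̄_i = Ψ_i + β log ρ_i`). -/
noncomputable def fpe2RHS {N : ℕ} (G : SimpleGraph (Fin N)) [DecidableRel G.Adj]
    (Ψ : Fin N → ℝ) (β : ℝ) (ρ : Fin N → ℝ) (i : Fin N) : ℝ :=
  (∑ j, if G.Adj i j ∧ Ψ i + β * Real.log (ρ i) < Ψ j + β * Real.log (ρ j) then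
      ((Ψ j + β * Real.log (ρ j)) - (Ψ i + β * Real.log (ρ i))) * ρ j else 0)
  + (∑ j, if G.Adj i j ∧ Ψ j + β * Real.log (ρ j) < Ψ i + β * Real.log (ρ i) then
      ((Ψ j + β * Real.log (ρ j)) - (Ψ i + β * Real.log (ρ i))) * ρ i else 0)

/-- `ρ : [0,∞) → M` is a solution of Fokker–Planck equation II. -/
def IsFPE2Sol {N : ℕ} (G : SimpleGraph (Fin N)) [DecidableRel G.Adj]
    (Ψ : Fin N → ℝ) (β : ℝ) (ρ : ℝ → Fin N → ℝ) : Prop :=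
  (∀ t, 0 ≤ t → IsProbDist (ρ t)) ∧
  ∀ t, 0 ≤ t → ∀ i,
    HasDerivWithinAt (fun s => ρ s i) (fpe2RHS G Ψ β (ρ t) i) (Set.Ici 0) t

/-- `η_i = (ρ_i − ρ*_i)/ρ*_i`. -/
noncomputable def etaOf {N : ℕ} (ρ ρstar : Fin N → ℝ) (i : Fin N) : ℝ :=
  (ρ i - ρstar i) / ρstar i

/-- `Ψ̄_i = Ψ_i + β log ρ_i`. -/
noncomputable def barPsi {N : ℕ} (Ψ : Fin N → ℝ) (β : ℝ) (ρ : Fin N → ℝ)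
    (i : Fin N) : ℝ :=
  Ψ i + β * Real.log (ρ i)

theorem gibbs_pos {N : ℕ} (Ψ : Fin N → ℝ) (β : ℝ) (i : Fin N) : 0 < gibbs Ψ β i :=
  div_pos (Real.exp_pos _) (Finset.sum_pos (fun _ _ => Real.exp_pos _) ⟨i, Finset.mem_univ i⟩)

theorem one_add_etaOf {N : ℕ} (ρ ρstar : Fin N → ℝ) {i : Fin N} (h : ρstar i ≠ 0) :
    1 + etaOf ρ ρstar i = ρ i / ρstar i := by
  unfold etaOf
  field_simp
  ring

theorem barPsi_eq_log_one_add_etaOf {N : ℕ} (Ψ : Fin N → ℝ) {β : ℝ} (hβ : β ≠ 0)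
    {ρ : Fin N → ℝ} {i : Fin N} (hρ : 0 < ρ i) :
    barPsi Ψ β ρ i = β * Real.log (1 + etaOf ρ (gibbs Ψ β) i)
      - β * Real.log (∑ j, Real.exp (-Ψ j / β)) := by
  have hK : 0 < ∑ j, Real.exp (-Ψ j / β) :=
    Finset.sum_pos (fun _ _ => Real.exp_pos _) ⟨i, Finset.mem_univ i⟩
  rw [one_add_etaOf _ _ (gibbs_pos Ψ β i).ne',
    Real.log_div hρ.ne' (gibbs_pos Ψ β i).ne', gibbs,
    Real.log_div (Real.exp_pos _).ne' hK.ne', Real.log_exp, barPsi]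
  field_simp
  ring

theorem etaOf_eq_of_barPsi_eq {N : ℕ} (Ψ : Fin N → ℝ) {β : ℝ} (hβ : β ≠ 0)
    {ρ : Fin N → ℝ} (hρ : ∀ i, 0 < ρ i) {i j : Fin N}
    (h : barPsi Ψ β ρ i = barPsi Ψ β ρ j) :
    etaOf ρ (gibbs Ψ β) i = etaOf ρ (gibbs Ψ β) j := by
  have hpos : ∀ k, 0 < 1 + etaOf ρ (gibbs Ψ β) k := fun k => by
    rw [one_add_etaOf _ _ (gibbs_pos Ψ β k).ne']
    exact div_pos (hρ k) (gibbs_pos Ψ β k)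
  rw [barPsi_eq_log_one_add_etaOf Ψ hβ (hρ i), barPsi_eq_log_one_add_etaOf Ψ hβ (hρ j)] at h
  have hlog := mul_left_cancel₀ hβ (sub_left_injective h)
  exact add_left_cancel (Real.log_injOn_pos (hpos i) (hpos j) hlog)

/-- The flux from `j` to `i` along an edge on which `Ψ̄_i < Ψ̄_j`, and `0` otherwise. -/
noncomputable def fpe2Flux {N : ℕ} (G : SimpleGraph (Fin N)) [DecidableRel G.Adj]
    (Ψ : Fin N → ℝ) (β : ℝ) (ρ : Fin N → ℝ) (i j : Fin N) : ℝ :=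
  if G.Adj i j ∧ barPsi Ψ β ρ i < barPsi Ψ β ρ j then
    (barPsi Ψ β ρ j - barPsi Ψ β ρ i) * ρ j else 0

theorem fpe2RHS_eq_sum_flux {N : ℕ} (G : SimpleGraph (Fin N)) [DecidableRel G.Adj]
    (Ψ : Fin N → ℝ) (β : ℝ) (ρ : Fin N → ℝ) (i : Fin N) :
    fpe2RHS G Ψ β ρ i = ∑ j, (fpe2Flux G Ψ β ρ i j - fpe2Flux G Ψ β ρ j i) := by
  rw [fpe2RHS, ← Finset.sum_add_distrib]
  refine Finset.sum_congr rfl fun j _ => ?_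
  simp only [fpe2Flux, barPsi, G.adj_comm j i]
  rw [sub_eq_add_neg]
  congr 1
  split_ifs <;> ring

theorem sum_mul_sum_sub_swap {ι : Type*} [Fintype ι] (a : ι → ℝ) (f : ι → ι → ℝ) :
    ∑ i, a i * ∑ j, (f i j - f j i) = -∑ i, ∑ j, (a j - a i) * f i j := by
  have hswap : ∑ i, ∑ j, a i * f j i = ∑ i, ∑ j, a j * f i j := Finset.sum_comm
  simp only [Finset.mul_sum, mul_sub, sub_mul, Finset.sum_sub_distrib, hswap]
  ring

theorem fpe2_L2_dissipation_identity {N : ℕ} (hN : 2 ≤ N)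
    (G : SimpleGraph (Fin N)) [DecidableRel G.Adj] (hG : G.Connected)
    (Ψ : Fin N → ℝ) (β : ℝ) (hβ : 0 < β)
    (ρ : ℝ → Fin N → ℝ) (hsol : IsFPE2Sol G Ψ β ρ) :
    ∀ t, 0 < t →
      HasDerivAt (fun s => ∑ i, (ρ s i - gibbs Ψ β i) ^ 2 / gibbs Ψ β i)
        (-(∑ i, ∑ j, if G.Adj i j ∧ barPsi Ψ β (ρ t) i < barPsi Ψ β (ρ t) j then
            2 * β * (Real.log (1 + etaOf (ρ t) (gibbs Ψ β) j) -
                Real.log (1 + etaOf (ρ t) (gibbs Ψ β) i)) *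
              (etaOf (ρ t) (gibbs Ψ β) j - etaOf (ρ t) (gibbs Ψ β) i) * ρ t j
          else 0)
         - (1 / 2) * ∑ i, ∑ j,
            if G.Adj i j ∧ barPsi Ψ β (ρ t) j = barPsi Ψ β (ρ t) i then
              2 * β * (etaOf (ρ t) (gibbs Ψ β) j - etaOf (ρ t) (gibbs Ψ β) i) ^ 2 *
                ((gibbs Ψ β i + gibbs Ψ β j) / 2)
            else 0) t := by
  intro t ht
  have hρ := (hsol.1 t ht.le).1
  have hρ' : ∀ i, HasDerivAt (fun s => ρ s i) (fpe2RHS G Ψ β (ρ t) i) t := fun i =>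
    (hsol.2 t ht.le i).hasDerivAt (Ici_mem_nhds ht)
  have hL := HasDerivAt.fun_sum (u := Finset.univ) fun i _ =>
    (((hρ' i).sub_const (gibbs Ψ β i)).fun_pow 2).div_const (gibbs Ψ β i)
  refine hL.congr_deriv ?_
  have hzero : ∑ i, ∑ j, (if G.Adj i j ∧ barPsi Ψ β (ρ t) j = barPsi Ψ β (ρ t) i then
      2 * β * (etaOf (ρ t) (gibbs Ψ β) j - etaOf (ρ t) (gibbs Ψ β) i) ^ 2 *
        ((gibbs Ψ β i + gibbs Ψ β j) / 2) else 0) = 0 := by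
    refine Finset.sum_eq_zero fun i _ => Finset.sum_eq_zero fun j _ => ?_
    split_ifs with h
    · rw [etaOf_eq_of_barPsi_eq Ψ hβ.ne' hρ h.2]
      ring
    · rfl
  rw [hzero, mul_zero, sub_zero]
  calc _ = ∑ i, 2 * etaOf (ρ t) (gibbs Ψ β) i *
        ∑ j, (fpe2Flux G Ψ β (ρ t) i j - fpe2Flux G Ψ β (ρ t) j i) := by
        refine Finset.sum_congr rfl fun i _ => ?_
        rw [← fpe2RHS_eq_sum_flux, etaOf]
        norm_num
        ring
    _ = _ := by
        rw [sum_mul_sum_sub_swap, neg_inj]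
        refine Finset.sum_congr rfl fun i _ => Finset.sum_congr rfl fun j _ => ?_
        unfold fpe2Flux
        split_ifs
        · rw [barPsi_eq_log_one_add_etaOf Ψ hβ.ne' (hρ i),
            barPsi_eq_log_one_add_etaOf Ψ hβ.ne' (hρ j)]
          ring
        · ring
end

section
/- Let G = (V,E) be a connected simple graph on N ≥ 2 vertices and ρ ∈ M. Define the weight w^m(ρ) by w^m_{ij}(ρ) = max{ρ_i, ρ_j} if {a_i,a_j} ∈ E and 0 otherwise, and the isoperimetric number i_{w^m(ρ)}(G) = min over nonempty X ⊆ V with |X| ≤ N/2 of (Σ_{a_i∈X, a_j∉X} w^m_{ij}(ρ)) / |X|. Then i_{w^m(ρ)}(G) ≥ 2·(min_{1≤i≤N} ρ_i)/N. -/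
/-!
STATEMENT 13: The isoperimetric number of the weighted graph (G, w^m(ρ)) is
at least 2 (min_i ρ_i)/N: for every nonempty X ⊆ V with |X| ≤ N/2,
(Σ_{a_i∈X, a_j∉X} w^m_{ij}(ρ))/|X| ≥ 2 (min_i ρ_i)/N.
-/

open Finset Real

/-- The "lower bound" weight matrix `w^m(ρ)`: `w^m_{ij} = max(ρ_i,ρ_j)` on
edges and `0` otherwise. -/
noncomputable def weightM {N : ℕ} (G : SimpleGraph (Fin N)) [DecidableRel G.Adj]
    (ρ : Fin N → ℝ) : Matrix (Fin N) (Fin N) ℝ :=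
  Matrix.of fun i j => if G.Adj i j then max (ρ i) (ρ j) else 0

theorem SimpleGraph.Connected.exists_adj_mem_notMem {V : Type*} {G : SimpleGraph V}
    (hG : G.Connected) {S : Set V} (hS : S.Nonempty) (hS' : Sᶜ.Nonempty) :
    ∃ a ∈ S, ∃ b ∉ S, G.Adj a b := by
  obtain ⟨u, hu⟩ := hS
  obtain ⟨v, hv⟩ := hS'
  obtain ⟨p⟩ := hG.preconnected u v
  obtain ⟨d, -, ha, hb⟩ := p.exists_boundary_dart S hu hv
  exact ⟨d.fst, ha, d.snd, hb, d.adj⟩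

theorem weightM_nonneg {N : ℕ} (G : SimpleGraph (Fin N)) [DecidableRel G.Adj]
    {ρ : Fin N → ℝ} (hρ : ∀ i, 0 ≤ ρ i) (i j : Fin N) : 0 ≤ weightM G ρ i j := by
  simp only [weightM, Matrix.of_apply]
  split_ifs
  · exact le_max_of_le_left (hρ i)
  · exact le_rfl

theorem isoperimetric_number_lower_bound {N : ℕ} (hN : 2 ≤ N)
    (G : SimpleGraph (Fin N)) [DecidableRel G.Adj] (hG : G.Connected)
    (ρ : Fin N → ℝ) (hρ : IsProbDist ρ) :
    ∀ X : Finset (Fin N), X.Nonempty → 2 * X.card ≤ N →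
      2 * (⨅ i, ρ i) / N ≤ (∑ i ∈ X, ∑ j ∈ Xᶜ, weightM G ρ i j) / X.card := by
  intro X hX hXN
  have hρ0 : ∀ i, 0 ≤ ρ i := fun i => (hρ.1 i).le
  have hXpos : 0 < X.card := hX.card_pos
  have hXc : Xᶜ.Nonempty := by
    rw [← Finset.card_pos, Finset.card_compl, Fintype.card_fin]
    omega
  obtain ⟨a, ha, b, hb, hab⟩ := hG.exists_adj_mem_notMem (S := (X : Set (Fin N)))
    (by simpa using hX) (by simpa [← Finset.coe_compl] using hXc)
  have hm : 0 ≤ ⨅ i, ρ i := Real.iInf_nonneg hρ0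
  have hcut : ⨅ i, ρ i ≤ ∑ i ∈ X, ∑ j ∈ Xᶜ, weightM G ρ i j :=
    calc ⨅ i, ρ i ≤ ρ a := ciInf_le (Set.finite_range ρ).bddBelow a
      _ ≤ weightM G ρ a b := by simp [weightM, hab]
      _ ≤ ∑ j ∈ Xᶜ, weightM G ρ a j :=
        Finset.single_le_sum (f := fun j => weightM G ρ a j)
          (fun j _ => weightM_nonneg G hρ0 a j) (by simpa using hb)
      _ ≤ ∑ i ∈ X, ∑ j ∈ Xᶜ, weightM G ρ i j :=
        Finset.single_le_sum (f := fun i => ∑ j ∈ Xᶜ, weightM G ρ i j)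
          (fun i _ => Finset.sum_nonneg fun j _ => weightM_nonneg G hρ0 i j) ha
  have hcard : (2 : ℝ) * X.card ≤ N := by exact_mod_cast hXN
  have hXR : (0 : ℝ) < X.card := by exact_mod_cast hXpos
  have hNR : (0 : ℝ) < N := by linarith
  rw [div_le_div_iff₀ hNR hXR]
  nlinarith [mul_le_mul_of_nonneg_left hcard hm, mul_le_mul_of_nonneg_right hcut hNR.le]
end

section
/- Let G = (V,E) be a connected simple graph on N ≥ 2 vertices with maximal degree D, and let ρ ∈ M. Let λ₂(ρ) denote the second smallest eigenvalue of the weighted Laplacian L(G, w^m(ρ)), where w^m_{ij}(ρ) = max{ρ_i, ρ_j} on edges and 0 otherwise. Then λ₂(ρ) ≥ 2·(min_{1≤i≤N} ρ_i)² / (D N²). -/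
/-!
STATEMENT 14: Spectral gap lower bound for the weighted Laplacian
L(G, w^m(ρ)):  λ₂(ρ) ≥ 2 (min_i ρ_i)² / (D N²), D the maximal degree of G.
-/

open Finset Real

/-- Weighted Laplacian `L(G,w) = diag(row sums) − w`. -/
noncomputable def wLap {N : ℕ} (w : Matrix (Fin N) (Fin N) ℝ) :
    Matrix (Fin N) (Fin N) ℝ :=
  Matrix.diagonal (fun i => ∑ j, w i j) - w

/-- The eigenvalues of a real symmetric matrix, sorted in nondecreasing order
(with multiplicity).  For a non-Hermitian matrix this returns the junk value `0`. -/
noncomputable def sortedEigs {N : ℕ} (A : Matrix (Fin N) (Fin N) ℝ) : Fin N → ℝ :=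
  if h : A.IsHermitian then h.eigenvalues ∘ Tuple.sort h.eigenvalues else 0

open Matrix in
theorem Matrix.IsHermitian.exists_sum_eq_zero_dotProduct_mulVec_le {n : Type*} [Fintype n]
    [DecidableEq n] {A : Matrix n n ℝ} (hA : A.IsHermitian) {i j : n} (hij : i ≠ j)
    (hle : hA.eigenvalues i ≤ hA.eigenvalues j) :
    ∃ x : n → ℝ, ∑ k, x k = 0 ∧ 0 < x ⬝ᵥ x ∧
      x ⬝ᵥ (A *ᵥ x) ≤ hA.eigenvalues j * (x ⬝ᵥ x) := by
  have horth : ∀ a b, (hA.eigenvectorBasis a : n → ℝ) ⬝ᵥ (hA.eigenvectorBasis b : n → ℝ) =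
      if a = b then 1 else 0 := by
    intro a b
    rw [← orthonormal_iff_ite.mp hA.eigenvectorBasis.orthonormal a b,
      EuclideanSpace.inner_eq_star_dotProduct, dotProduct_comm]
    simp
  have hi := hA.mulVec_eigenvectorBasis i
  have hj := hA.mulVec_eigenvectorBasis j
  have hii := horth i i
  have hjj := horth j j
  have hij' := horth i j
  have hji' := horth j i
  simp only [if_true, if_neg hij, if_neg hij.symm] at hii hjj hij' hji'
  generalize hu : (hA.eigenvectorBasis i : n → ℝ) = u at *
  generalize hv : (hA.eigenvectorBasis j : n → ℝ) = v at *
  obtain ⟨α, β, hne, hsum⟩ : ∃ α β : ℝ, 0 < α ^ 2 + β ^ 2 ∧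
      α * ∑ k, u k + β * ∑ k, v k = 0 := by
    by_cases h : ∑ k, u k = 0
    · exact ⟨1, 0, by norm_num, by simp [h]⟩
    · exact ⟨∑ k, v k, -∑ k, u k,
        by nlinarith [sq_nonneg (∑ k, v k), sq_pos_of_ne_zero h], by ring⟩
  have hnorm : (α • u + β • v) ⬝ᵥ (α • u + β • v) = α ^ 2 + β ^ 2 := by
    simp only [add_dotProduct, dotProduct_add, smul_dotProduct, dotProduct_smul, smul_eq_mul,
      hii, hjj, hij', hji']
    ring
  refine ⟨α • u + β • v, ?_, hnorm ▸ hne, ?_⟩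
  · simpa [Finset.sum_add_distrib, Finset.mul_sum] using hsum
  · rw [hnorm]
    simp only [mulVec_add, mulVec_smul, hi, hj, add_dotProduct, dotProduct_add, smul_dotProduct,
      dotProduct_smul, smul_eq_mul, hii, hjj, hij', hji']
    nlinarith [mul_le_mul_of_nonneg_left hle (sq_nonneg α)]

theorem SimpleGraph.Walk.sub_eq_sum_darts {V : Type*} {G : SimpleGraph V} (x : V → ℝ) {a b : V}
    (p : G.Walk a b) : x a - x b = (p.darts.map fun d => x d.fst - x d.snd).sum := by
  induction p with
  | nil => simp
  | cons h p ih => simp [← ih]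

theorem SimpleGraph.Connected.sq_sub_le_card_mul_sum {V : Type*} [Fintype V] [DecidableEq V]
    {G : SimpleGraph V} [DecidableRel G.Adj] (hG : G.Connected) (x : V → ℝ) (a b : V) :
    (x a - x b) ^ 2 ≤
      Fintype.card V * ∑ i, ∑ j, if G.Adj i j then (x i - x j) ^ 2 else 0 := by
  obtain ⟨p, hp⟩ := hG.exists_isPath a b
  have hnodup : p.darts.Nodup := hp.isTrail.edges_nodup.of_map _
  rw [p.sub_eq_sum_darts, ← List.sum_toFinset _ hnodup]
  refine sq_sum_le_card_mul_sum_sq.trans ?_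
  have hcard : p.darts.toFinset.card ≤ Fintype.card V := by
    rw [List.toFinset_card_of_nodup hnodup, SimpleGraph.Walk.length_darts]
    exact hp.length_lt.le
  have hsum : ∑ d ∈ p.darts.toFinset, (x d.fst - x d.snd) ^ 2 ≤
      ∑ i, ∑ j, if G.Adj i j then (x i - x j) ^ 2 else 0 := by
    rw [← Fintype.sum_prod_type' (f := fun i j => if G.Adj i j then (x i - x j) ^ 2 else 0)]
    calc ∑ d ∈ p.darts.toFinset, (x d.fst - x d.snd) ^ 2
        = ∑ q ∈ p.darts.toFinset.map ⟨_, SimpleGraph.Dart.toProd_injective⟩,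
            if G.Adj q.1 q.2 then (x q.1 - x q.2) ^ 2 else 0 := by
          rw [Finset.sum_map]
          exact Finset.sum_congr rfl fun d _ => (if_pos d.adj).symm
      _ ≤ _ := Finset.sum_le_univ_sum_of_nonneg fun q => by positivity
  gcongr

theorem sum_sum_sq_sub {V : Type*} [Fintype V] {x : V → ℝ} (hx : ∑ i, x i = 0) :
    ∑ i, ∑ j, (x i - x j) ^ 2 = 2 * Fintype.card V * ∑ i, x i ^ 2 := by
  simp only [sub_sq, Finset.sum_add_distrib, Finset.sum_sub_distrib, ← Finset.mul_sum, hx,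
    Finset.sum_const, Finset.card_univ, nsmul_eq_mul, mul_zero]
  ring

theorem SimpleGraph.Connected.poincare {V : Type*} [Fintype V] [DecidableEq V]
    {G : SimpleGraph V} [DecidableRel G.Adj] (hG : G.Connected) {x : V → ℝ}
    (hx : ∑ i, x i = 0) :
    2 * ∑ i, x i ^ 2 ≤
      (Fintype.card V : ℝ) ^ 2 * ∑ i, ∑ j, if G.Adj i j then (x i - x j) ^ 2 else 0 := by
  have := hG.nonempty
  have hpos : (0 : ℝ) < Fintype.card V := by exact_mod_cast Fintype.card_pos
  refine le_of_mul_le_mul_left ?_ hpos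
  calc (Fintype.card V : ℝ) * (2 * ∑ i, x i ^ 2) = ∑ i, ∑ j, (x i - x j) ^ 2 := by
        rw [sum_sum_sq_sub hx]; ring
    _ ≤ ∑ _i : V, ∑ _j : V,
          Fintype.card V * ∑ i, ∑ j, if G.Adj i j then (x i - x j) ^ 2 else 0 :=
        Finset.sum_le_sum fun a _ => Finset.sum_le_sum fun b _ => hG.sq_sub_le_card_mul_sum x a b
    _ = _ := by
        simp only [Finset.sum_const, Finset.card_univ, nsmul_eq_mul]
        ring

theorem weightM_isSymm {N : ℕ} (G : SimpleGraph (Fin N)) [DecidableRel G.Adj] (ρ : Fin N → ℝ) :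
    (weightM G ρ).IsSymm := by
  ext i j
  simp [weightM, G.adj_comm, max_comm]

theorem wLap_isHermitian {N : ℕ} {w : Matrix (Fin N) (Fin N) ℝ} (hw : w.IsSymm) :
    (wLap w).IsHermitian := by
  refine (Matrix.isHermitian_diagonal _).sub ?_
  simpa [Matrix.IsHermitian, Matrix.conjTranspose_eq_transpose_of_trivial] using hw.eq

open Matrix in
theorem two_mul_dotProduct_wLap_mulVec {N : ℕ} {w : Matrix (Fin N) (Fin N) ℝ} (hw : w.IsSymm)
    (x : Fin N → ℝ) :
    2 * (x ⬝ᵥ (wLap w *ᵥ x)) = ∑ i, ∑ j, w i j * (x i - x j) ^ 2 := by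
  have hsymm : ∑ i, ∑ j, w i j * x j ^ 2 = ∑ i, ∑ j, w i j * x i ^ 2 := by
    rw [Finset.sum_comm]
    exact Finset.sum_congr rfl fun i _ => Finset.sum_congr rfl fun j _ => by rw [hw.apply]
  have hlap : x ⬝ᵥ (wLap w *ᵥ x) =
      ∑ i, ∑ j, w i j * x i ^ 2 - ∑ i, ∑ j, w i j * (x i * x j) := by
    rw [wLap, sub_mulVec, dotProduct_sub]
    simp only [dotProduct, mulVec_diagonal]
    simp only [mulVec, dotProduct, Finset.mul_sum, Finset.sum_mul]
    congr 1 <;> exact Finset.sum_congr rfl fun i _ => Finset.sum_congr rfl fun j _ => by ring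
  have hexp : ∑ i, ∑ j, w i j * (x i - x j) ^ 2 = ∑ i, ∑ j, w i j * x i ^ 2 -
      2 * ∑ i, ∑ j, w i j * (x i * x j) + ∑ i, ∑ j, w i j * x j ^ 2 := by
    simp only [Finset.mul_sum, ← Finset.sum_sub_distrib, ← Finset.sum_add_distrib]
    exact Finset.sum_congr rfl fun i _ => Finset.sum_congr rfl fun j _ => by ring
  rw [hexp, hlap, hsymm]
  ring

open Matrix in
theorem le_sortedEigs_wLap_weightM {N : ℕ} {G : SimpleGraph (Fin N)}
    [DecidableRel G.Adj] (hG : G.Connected) {ρ : Fin N → ℝ} {m : ℝ} (hm : 0 ≤ m)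
    (hmρ : ∀ i, m ≤ ρ i) {l k : Fin N} (hlk : l < k) :
    m / (N : ℝ) ^ 2 ≤ sortedEigs (wLap (weightM G ρ)) k := by
  have hsymm := weightM_isSymm G ρ
  have hA := wLap_isHermitian hsymm
  simp only [sortedEigs, dif_pos hA, Function.comp_apply]
  have hij := (Tuple.sort hA.eigenvalues).injective.ne hlk.ne
  have hle := Tuple.monotone_sort hA.eigenvalues hlk.le
  obtain ⟨x, hx0, hxpos, hx⟩ := hA.exists_sum_eq_zero_dotProduct_mulVec_le hij hle
  have hweight : m * ∑ i, ∑ j, (if G.Adj i j then (x i - x j) ^ 2 else 0) ≤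
      2 * (x ⬝ᵥ (wLap (weightM G ρ) *ᵥ x)) := by
    rw [two_mul_dotProduct_wLap_mulVec hsymm]
    simp only [Finset.mul_sum]
    refine Finset.sum_le_sum fun i _ => Finset.sum_le_sum fun j _ => ?_
    by_cases h : G.Adj i j
    · simp only [weightM, Matrix.of_apply, if_pos h]
      gcongr
      exact (hmρ i).trans (le_max_left _ _)
    · simp [weightM, h]
  have hpoincare := hG.poincare hx0
  have hdot : x ⬝ᵥ x = ∑ i, x i ^ 2 := by simp [dotProduct, sq]
  rw [Fintype.card_fin, ← hdot] at hpoincare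
  have hNpos : (0 : ℝ) < (N : ℝ) ^ 2 := pow_pos (Nat.cast_pos.mpr k.pos) 2
  rw [div_le_iff₀ hNpos]
  refine le_of_mul_le_mul_right ?_ (mul_pos two_pos hxpos)
  have h₁ := mul_le_mul_of_nonneg_left hpoincare hm
  have h₂ := mul_le_mul_of_nonneg_left (hweight.trans (mul_le_mul_of_nonneg_left hx two_pos.le))
    hNpos.le
  linarith

theorem weighted_spectral_gap_lower_bound {N : ℕ} (hN : 2 ≤ N)
    (G : SimpleGraph (Fin N)) [DecidableRel G.Adj] (hG : G.Connected)
    (ρ : Fin N → ℝ) (hρ : IsProbDist ρ) :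
    2 * (⨅ i, ρ i) ^ 2 /
        (((Finset.univ.sup fun i => G.degree i : ℕ) : ℝ) * (N : ℝ) ^ 2) ≤
      sortedEigs (wLap (weightM G ρ)) ⟨1, by omega⟩ := by
  have hρpos := hρ.1
  have : Nontrivial (Fin N) := Fin.nontrivial_iff_two_le.mpr hN
  set m := ⨅ i, ρ i with hm
  set D := Finset.univ.sup fun i => G.degree i with hD
  have hmρ : ∀ i, m ≤ ρ i := fun i => ciInf_le (Set.finite_range ρ).bddBelow i
  have hm0 : 0 ≤ m := Real.iInf_nonneg fun i => (hρpos i).le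
  have hDpos : (1 : ℝ) ≤ D := by
    let i : Fin N := ⟨0, by omega⟩
    exact_mod_cast (Nat.succ_le_of_lt (hG.preconnected.degree_pos_of_nontrivial i)).trans
      (Finset.le_sup (f := fun i => G.degree i) (Finset.mem_univ i))
  have hm2 : 2 * m ≤ 1 := by
    have h := Finset.sum_le_sum fun i (_ : i ∈ Finset.univ) => hmρ i
    rw [hρ.2, Finset.sum_const, Finset.card_univ, Fintype.card_fin, nsmul_eq_mul] at h
    exact (mul_le_mul_of_nonneg_right (by exact_mod_cast hN) hm0).trans h
  refine le_trans ?_ (le_sortedEigs_wLap_weightM hG hm0 hmρ (l := ⟨0, by omega⟩) (by simp))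
  rw [← div_div]
  gcongr
  rw [div_le_iff₀ (by linarith)]
  nlinarith
end
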